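/- Let C_λ and C_γ be the attractors of iterated function systems on ℝ of the form {x ↦ λx + b_i : i = 1,…,A} and {x ↦ γx + c_j : j = 1,…,B} respectively (all maps orientation-preserving with common contraction ratios λ and γ), and suppose both C_λ and C_γ have closed convex hull [0,1]. Let d_λ = log A / log(1/λ) and d_γ = log B / log(1/γ) be the similarity dimensions. Then the (d_λ + d_γ)-dimensional Hausdorff measure of the arithmetic sum C_λ + C_γ = {x + y : x ∈ C_λ, y ∈ C_γ} is zero. -/

import Mathlib

open MeasureTheory Pointwise
open scoped ENNReal NNReal

noncomputable def cont (d : ℝ) (hd : 0 < d) : OuterMeasure ℝ :=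
  OuterMeasure.ofFunction (fun s => Metric.ediam s ^ d) (by simp [hd])

lemma cont_le (d : ℝ) (hd : 0 < d) (s : Set ℝ) : cont d hd s ≤ Metric.ediam s ^ d :=
  OuterMeasure.ofFunction_le _

lemma cont_scale (d : ℝ) (hd : 0 < d) (r a : ℝ) (hr : 0 < r) (s : Set ℝ) :
    cont d hd ((fun x => r * x + a) '' s) ≤ ENNReal.ofReal (r ^ d) * cont d hd s := by
  have h : OuterMeasure.comap (fun x => r * x + a) (cont d hd) ≤
      ENNReal.ofReal (r ^ d) • cont d hd := by
    unfold cont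
    rw [OuterMeasure.smul_ofFunction (by simp), OuterMeasure.le_ofFunction]
    intro s
    rw [OuterMeasure.comap_apply]
    refine (cont_le d hd _).trans ?_
    have hL : LipschitzWith (Real.toNNReal r) (fun x : ℝ => r * x + a) := by
      apply LipschitzWith.of_dist_le_mul
      intro x y
      rw [Real.dist_eq, Real.dist_eq, Real.coe_toNNReal _ hr.le,
        show r * x + a - (r * y + a) = r * (x - y) by ring, abs_mul, abs_of_pos hr]
    have h2 := ENNReal.rpow_le_rpow (hL.ediam_image_le s) hd.le
    rw [ENNReal.mul_rpow_of_nonneg _ _ hd.le] at h2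
    rw [← ENNReal.ofReal_rpow_of_pos hr]
    exact h2
  exact h s

lemma exists_open_diam (d : ℝ) (hd : 0 < d) (s : Set ℝ) (ε : ℝ≥0∞) (hε : 0 < ε) :
    ∃ U, IsOpen U ∧ s ⊆ U ∧ Metric.ediam U ^ d ≤ Metric.ediam s ^ d + ε := by
  by_cases hs : Metric.ediam s = ⊤
  · exact ⟨Set.univ, isOpen_univ, Set.subset_univ _, by simp [hs, hd]⟩
  have hc : Filter.Tendsto (fun δ : ℝ => (Metric.ediam s + 2 * ENNReal.ofReal δ) ^ d)
      (nhdsWithin 0 (Set.Ioi 0)) (nhds (Metric.ediam s ^ d)) := by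
    have : Continuous (fun δ : ℝ => (Metric.ediam s + 2 * ENNReal.ofReal δ) ^ d) := by
      refine ENNReal.continuous_rpow_const.comp ?_
      refine continuous_const.add ?_
      exact (ENNReal.continuous_const_mul (by simp)).comp ENNReal.continuous_ofReal
    have h := this.tendsto 0
    simp only [ENNReal.ofReal_zero, mul_zero, add_zero] at h
    exact h.mono_left nhdsWithin_le_nhds
  have hlt : Metric.ediam s ^ d < Metric.ediam s ^ d + ε :=
    ENNReal.lt_add_right (ENNReal.rpow_ne_top_of_nonneg hd.le hs) hε.ne'
  obtain ⟨δ, h1, h2⟩ := ((hc.eventually_lt_const hlt).and self_mem_nhdsWithin).exists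
  have h2 : 0 < δ := h2
  refine ⟨Metric.thickening δ s, Metric.isOpen_thickening, Metric.self_subset_thickening h2 s, ?_⟩
  refine le_trans (ENNReal.rpow_le_rpow ?_ hd.le) h1.le
  have := Metric.ediam_thickening_le (s := s) (Real.toNNReal δ)
  rw [Real.coe_toNNReal _ h2.le] at this
  exact this

lemma cont_open (d : ℝ) (hd : 0 < d) (s : Set ℝ) (c : ℝ≥0∞) (hc : cont d hd s < c) :
    ∃ U, IsOpen U ∧ s ⊆ U ∧ cont d hd U < c := by
  have hc' := hc
  unfold cont at hc'
  rw [OuterMeasure.ofFunction_apply] at hc'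
  simp only [iInf_lt_iff] at hc'
  obtain ⟨t, ht, hsum⟩ := hc'
  obtain ⟨δ, δ0, hδ⟩ := ENNReal.exists_pos_sum_of_countable' (tsub_pos_iff_lt.2 hsum).ne' ℕ
  choose U hU1 hU2 hU3 using fun n => exists_open_diam d hd (t n) (δ n) (δ0 n)
  refine ⟨⋃ n, U n, isOpen_iUnion hU1, ht.trans (Set.iUnion_mono hU2), ?_⟩
  calc cont d hd (⋃ n, U n) ≤ ∑' n, cont d hd (U n) := measure_iUnion_le _
    _ ≤ ∑' n, (Metric.ediam (t n) ^ d + δ n) :=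
        ENNReal.tsum_le_tsum fun n => (cont_le d hd _).trans (hU3 n)
    _ = ∑' n, Metric.ediam (t n) ^ d + ∑' n, δ n := ENNReal.tsum_add
    _ < ∑' n, Metric.ediam (t n) ^ d + (c - ∑' n, Metric.ediam (t n) ^ d) :=
        ENNReal.add_lt_add_left hsum.ne_top hδ
    _ = c := add_tsub_cancel_of_le hsum.le

lemma hausdorff_zero (d : ℝ) (hd : 0 < d) (s : Set ℝ) (hs : cont d hd s = 0) :
    μH[d] s = 0 := by
  rw [Measure.hausdorffMeasure_apply]
  simp only [ENNReal.iSup_eq_zero]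
  intro r hr
  refine le_antisymm (le_of_forall_gt fun ε hε => ?_) bot_le
  have hlt : cont d hd s < min ε (r ^ d) := by
    rw [hs]
    refine lt_min hε ?_
    by_cases h : r = ⊤
    · simp [h, hd]
    · exact ENNReal.rpow_pos hr h
  unfold cont at hlt
  rw [OuterMeasure.ofFunction_apply] at hlt
  simp only [iInf_lt_iff] at hlt
  obtain ⟨t, ht, hsum⟩ := hlt
  simp only [iInf_lt_iff]
  refine ⟨t, ht, fun n => ?_, lt_of_le_of_lt (ENNReal.tsum_le_tsum fun n => ?_)
    (hsum.trans_le (min_le_left _ _))⟩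
  · rw [← ENNReal.rpow_le_rpow_iff hd]
    exact (ENNReal.le_tsum n).trans (hsum.le.trans (min_le_right _ _))
  · exact iSup_le fun _ => le_rfl

lemma hull_facts (C : Set ℝ) (hc : IsCompact C) (hn : C.Nonempty)
    (hh : convexHull ℝ C = Set.Icc 0 1) : C ⊆ Set.Icc 0 1 ∧ (0:ℝ) ∈ C ∧ (1:ℝ) ∈ C := by
  have hsub : C ⊆ Set.Icc 0 1 := hh ▸ subset_convexHull ℝ C
  have hi := hc.sInf_mem hn
  have hs := hc.sSup_mem hn
  have h : convexHull ℝ C ⊆ Set.Icc (sInf C) (sSup C) :=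
    convexHull_min (fun x hx => ⟨csInf_le hc.bddBelow hx, le_csSup hc.bddAbove hx⟩)
      (convex_Icc _ _)
  rw [hh] at h
  have h0 := (h (Set.left_mem_Icc.2 zero_le_one)).1
  have h1 := (h (Set.right_mem_Icc.2 zero_le_one)).2
  have e0 : sInf C = 0 := le_antisymm h0 (hsub hi).1
  have e1 : sSup C = 1 := le_antisymm (hsub hs).2 h1
  exact ⟨hsub, e0 ▸ hi, e1 ▸ hs⟩

lemma ends (ι : Type) (C : Set ℝ) (h01 : C ⊆ Set.Icc 0 1) (h0 : (0:ℝ) ∈ C) (h1 : (1:ℝ) ∈ C)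
    (l : ℝ) (hl : 0 < l) (b : ι → ℝ) (hinv : C = ⋃ i, (fun x => l * x + b i) '' C) :
    ∃ i j, b i = 0 ∧ b j = 1 - l := by
  have hm : ∀ i, ∀ x ∈ C, l * x + b i ∈ C := fun i x hx => by
    rw [hinv]; exact Set.mem_iUnion.2 ⟨i, x, hx, rfl⟩
  have h0' := h0
  have h1' := h1
  rw [hinv] at h0' h1'
  obtain ⟨i, x, hx, hxi⟩ := Set.mem_iUnion.1 h0'
  obtain ⟨j, y, hy, hyj⟩ := Set.mem_iUnion.1 h1'
  refine ⟨i, j, ?_, ?_⟩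
  · have := (h01 (hm i 0 h0)).1
    have := mul_nonneg hl.le (h01 hx).1
    simp only at hxi
    linarith
  · have := (h01 (hm j 1 h1)).2
    have := mul_le_mul_of_nonneg_left (h01 hy).2 hl.le
    simp only at hyj
    linarith

lemma iterate_ifs (A : ℕ) (C : Set ℝ) (l : ℝ) (b : Fin A → ℝ)
    (hinv : C = ⋃ i, (fun x => l * x + b i) '' C) (n : ℕ) :
    ∃ β : (Fin n → Fin A) → ℝ, C = ⋃ i, (fun x => l ^ n * x + β i) '' C := by
  induction n with
  | zero =>
    have : Nonempty (Fin 0 → Fin A) := ⟨fun i => i.elim0⟩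
    refine ⟨fun _ => 0, ?_⟩
    simp only [pow_zero, one_mul, add_zero, Set.image_id']
    exact (Set.iUnion_const C).symm
  | succ n ih =>
    obtain ⟨β, hβ⟩ := ih
    refine ⟨fun u => l ^ n * b (u 0) + β (Fin.tail u), ?_⟩
    ext z
    constructor
    · intro hz
      rw [hβ] at hz
      obtain ⟨u, x, hx, hxz⟩ := Set.mem_iUnion.1 hz
      rw [hinv] at hx
      obtain ⟨i, y, hy, hyx⟩ := Set.mem_iUnion.1 hx
      refine Set.mem_iUnion.2 ⟨Fin.cons i u, y, hy, ?_⟩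
      simp only [Fin.cons_zero, Fin.tail_cons] at *
      rw [← hxz, ← hyx]; ring
    · intro hz
      obtain ⟨u, y, hy, hyz⟩ := Set.mem_iUnion.1 hz
      rw [hβ]
      refine Set.mem_iUnion.2 ⟨Fin.tail u, l * y + b (u 0), ?_, ?_⟩
      · rw [hinv]; exact Set.mem_iUnion.2 ⟨u 0, y, hy, rfl⟩
      · simp only at *
        rw [← hyz]; ring

lemma dirichlet (l g : ℝ) (hl : l ∈ Set.Ioo (0:ℝ) 1) (hg : g ∈ Set.Ioo (0:ℝ) 1)
    (K : ℕ) (ε : ℝ) (hε : 0 < ε) :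
    ∃ n m : ℕ, K ≤ n ∧ K ≤ m ∧ |g ^ m / l ^ n - 1| < ε := by
  have ha : 0 < -Real.log l := by have := Real.log_neg hl.1 hl.2; linarith
  have hb : 0 < -Real.log g := by have := Real.log_neg hg.1 hg.2; linarith
  set a := -Real.log l with hadef
  set β := -Real.log g with hbdef
  have hcont : Filter.Tendsto (fun x : ℝ => Real.exp x) (nhds 0) (nhds 1) := by
    simpa using Real.continuous_exp.tendsto 0
  obtain ⟨η, hη, hexp⟩ := Metric.tendsto_nhds_nhds.1 hcont ε hε
  have hξ : 0 < a / β := div_pos ha hb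
  obtain ⟨N, hN⟩ := exists_nat_gt (max (1 / (a / β)) ((K : ℝ) * β / η))
  have hN1 := (le_max_left _ _).trans_lt hN
  have hN2 := (le_max_right _ _).trans_lt hN
  have hN0 : 0 < N := by
    have : (0:ℝ) < N := lt_trans (by positivity) hN1
    exact_mod_cast this
  obtain ⟨k, hk0, hkN, hk⟩ := Real.exists_nat_abs_mul_sub_round_le (a / β) hN0
  have hk1 : (1:ℝ) ≤ k := by exact_mod_cast hk0
  have hNp : (0:ℝ) < N + 1 := by positivity
  have hsmall : 1 / ((N:ℝ) + 1) < a / β := by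
    rw [div_lt_iff₀ hξ] at hN1
    rw [div_lt_iff₀ hNp]
    nlinarith
  have hm1 : 1 ≤ round ((k:ℝ) * (a / β)) := by
    by_contra hcon
    have hle : round ((k:ℝ) * (a / β)) ≤ 0 := by omega
    have hle' : (round ((k:ℝ) * (a / β)) : ℝ) ≤ 0 := by exact_mod_cast hle
    have := (abs_le.1 hk).2
    nlinarith
  obtain ⟨m, hm⟩ := Int.eq_ofNat_of_zero_le (show 0 ≤ round ((k:ℝ) * (a / β)) by omega)
  rw [hm] at hk hm1
  have hm1' : 1 ≤ m := by exact_mod_cast hm1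
  refine ⟨K * k, K * m, Nat.le_mul_of_pos_right _ hk0, Nat.le_mul_of_pos_right _ hm1', ?_⟩
  have key : g ^ (K * m) / l ^ (K * k) =
      Real.exp (K * β * ((k:ℝ) * (a / β) - ((m:ℕ):ℝ))) := by
    have e1 : (K:ℝ) * β * ((k:ℝ) * (a / β) - ((m:ℕ):ℝ)) =
        ((K * m : ℕ) : ℝ) * Real.log g - ((K * k : ℕ) : ℝ) * Real.log l := by
      have : β * (a / β) = a := by field_simp
      push_cast
      have h2 : (K:ℝ) * β * ((k:ℝ) * (a / β) - (m:ℝ)) =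
        K * k * (β * (a / β)) - K * m * β := by ring
      rw [h2, this, hadef, hbdef]; ring
    rw [e1, Real.exp_sub, Real.exp_nat_mul, Real.exp_nat_mul, Real.exp_log hl.1, Real.exp_log hg.1]
  rw [key]
  have hd := @hexp (K * β * ((k:ℝ) * (a / β) - ((m:ℕ):ℝ))) ?_
  · rwa [Real.dist_eq] at hd
  · rw [Real.dist_eq, sub_zero, abs_mul, abs_of_nonneg (by positivity : (0:ℝ) ≤ K * β)]
    have hk' : |(k:ℝ) * (a / β) - ((m:ℕ):ℝ)| ≤ 1 / ((N:ℝ) + 1) := by exact_mod_cast hk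
    refine (mul_le_mul_of_nonneg_left hk' (by positivity)).trans_lt ?_
    rw [div_lt_iff₀ hη] at hN2
    rw [mul_one_div, div_lt_iff₀ hNp]
    nlinarith

def sumSet (C D : Set ℝ) (t : ℝ) : Set ℝ := (fun p : ℝ × ℝ => p.1 + t * p.2) '' (C ×ˢ D)

lemma sumSet_compact (C D : Set ℝ) (t : ℝ) (hC : IsCompact C) (hD : IsCompact D) :
    IsCompact (sumSet C D t) :=
  (hC.prod hD).image (by fun_prop)

lemma cont_ne_top (d : ℝ) (hd : 0 < d) (s : Set ℝ) (hs : IsCompact s) : cont d hd s ≠ ⊤ :=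
  ((cont_le d hd s).trans_lt
    (ENNReal.rpow_lt_top_of_nonneg hd.le hs.isBounded.ediam_ne_top)).ne

lemma sumSet_decomp (ι κ : Type) (C D : Set ℝ) (L G : ℝ) (hL : 0 < L)
    (b : ι → ℝ) (c : κ → ℝ)
    (hC : C = ⋃ i, (fun x => L * x + b i) '' C) (hD : D = ⋃ i, (fun x => G * x + c i) '' D)
    (t : ℝ) : sumSet C D t ⊆ ⋃ p : ι × κ,
      (fun x => L * x + (b p.1 + t * c p.2)) '' sumSet C D (t * G / L) := by
  rintro _ ⟨⟨x, y⟩, ⟨hx, hy⟩, rfl⟩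
  simp only at hx hy
  rw [hC] at hx
  rw [hD] at hy
  obtain ⟨i, x', hx', rfl⟩ := Set.mem_iUnion.1 hx
  obtain ⟨j, y', hy', rfl⟩ := Set.mem_iUnion.1 hy
  refine Set.mem_iUnion.2 ⟨(i, j), _, ⟨(x', y'), ⟨hx', hy'⟩, rfl⟩, ?_⟩
  simp only
  field_simp
  ring

lemma cont_step (ι κ : Type) [Fintype ι] [Fintype κ] (d : ℝ) (hd : 0 < d)
    (C D : Set ℝ) (hCc : IsCompact C) (hDc : IsCompact D) (L G : ℝ) (hL : 0 < L)
    (b : ι → ℝ) (c : κ → ℝ)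
    (hC : C = ⋃ i, (fun x => L * x + b i) '' C) (hD : D = ⋃ i, (fun x => G * x + c i) '' D)
    (t : ℝ) : (cont d hd (sumSet C D t)).toReal ≤
      (Fintype.card ι : ℝ) * Fintype.card κ * L ^ d * (cont d hd (sumSet C D (t * G / L))).toReal := by
  have h : cont d hd (sumSet C D t) ≤
      (Fintype.card ι * Fintype.card κ : ℕ) * (ENNReal.ofReal (L ^ d) *
        cont d hd (sumSet C D (t * G / L))) := by
    calc _ ≤ cont d hd (⋃ p : ι × κ,
          (fun x => L * x + (b p.1 + t * c p.2)) '' sumSet C D (t * G / L)) :=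
          measure_mono (sumSet_decomp ι κ C D L G hL b c hC hD t)
      _ ≤ ∑ p : ι × κ, cont d hd ((fun x => L * x + (b p.1 + t * c p.2)) ''
          sumSet C D (t * G / L)) := measure_iUnion_fintype_le _ _
      _ ≤ ∑ p : ι × κ, (ENNReal.ofReal (L ^ d) * cont d hd (sumSet C D (t * G / L))) :=
          Finset.sum_le_sum fun p _ => cont_scale d hd L _ hL _
      _ = _ := by
          rw [Finset.sum_const, Finset.card_univ, Fintype.card_prod, nsmul_eq_mul]
  have hfin := cont_ne_top d hd _ (sumSet_compact C D (t * G / L) hCc hDc)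
  have h2 := ENNReal.toReal_mono (by finiteness) h
  rw [ENNReal.toReal_mul, ENNReal.toReal_mul, ENNReal.toReal_ofReal (by positivity),
    ENNReal.toReal_natCast] at h2
  push_cast at h2
  linarith

lemma cont_save (ι κ : Type) [Fintype ι] [Fintype κ] (d : ℝ) (hd : 0 < d)
    (C D : Set ℝ) (hCc : IsCompact C) (hDc : IsCompact D) (L G : ℝ) (hL : 0 < L) (hL1 : L < 1)
    (b : ι → ℝ) (c : κ → ℝ)
    (hC : C = ⋃ i, (fun x => L * x + b i) '' C) (hD : D = ⋃ i, (fun x => G * x + c i) '' D)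
    (i0 i1 : ι) (j0 j1 : κ) (hi0 : b i0 = 0) (hi1 : b i1 = 1 - L) (hj0 : c j0 = 0)
    (hj1 : c j1 = 1 - G) :
    (cont d hd (sumSet C D 1)).toReal ≤
      ((Fintype.card ι : ℝ) * Fintype.card κ - 2) * (L ^ d * (cont d hd (sumSet C D (G / L))).toReal)
      + L ^ d * (cont d hd (sumSet C D (G / L) ∪
          (fun x => x + (G / L - 1)) '' sumSet C D (G / L))).toReal := by
  classical
  set E := sumSet C D (G / L) ∪ (fun x => x + (G / L - 1)) '' sumSet C D (G / L) with hE
  have hcomp := sumSet_compact C D (G / L) hCc hDc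
  have hEc : IsCompact E := hcomp.union (hcomp.image (by fun_prop))
  set F : Finset (ι × κ) := (Finset.univ.erase (i1, j0)).erase (i0, j1) with hF
  have hne : (i0, j1) ≠ (i1, j0) := by
    intro h
    have : i0 = i1 := congrArg Prod.fst h
    rw [this, hi1] at hi0
    linarith
  have hcard : F.card + 2 = Fintype.card ι * Fintype.card κ := by
    have h1 := Finset.card_erase_add_one (Finset.mem_univ (i1, j0))
    have h2 : F.card + 1 = (Finset.univ.erase (i1, j0)).card := Finset.card_erase_add_one
      (Finset.mem_erase.2 ⟨hne, Finset.mem_univ (i0, j1)⟩)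
    rw [Finset.card_univ, Fintype.card_prod] at h1
    omega
  have hsub : sumSet C D 1 ⊆ (⋃ p ∈ F, (fun x => L * x + (b p.1 + c p.2)) '' sumSet C D (G / L)) ∪
      (fun x => L * x + (1 - G)) '' E := by
    intro z hz
    have h := sumSet_decomp ι κ C D L G hL b c hC hD 1 hz
    simp only [one_mul] at h
    obtain ⟨p, x, hx, hxz⟩ := Set.mem_iUnion.1 h
    simp only at hxz
    by_cases hp1 : p = (i1, j0)
    · right
      refine ⟨x + (G / L - 1), Or.inr ⟨x, hx, rfl⟩, ?_⟩
      rw [← hxz, hp1]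
      simp only [hi1, hj0]
      field_simp
      ring
    by_cases hp2 : p = (i0, j1)
    · right
      refine ⟨x, Or.inl hx, ?_⟩
      rw [← hxz, hp2]
      simp only [hi0, hj1]
      ring
    left
    refine Set.mem_iUnion₂.2 ⟨p, ?_, x, hx, hxz⟩
    simp [hF, hp1, hp2]
  have h : cont d hd (sumSet C D 1) ≤
      (F.card : ℕ) * (ENNReal.ofReal (L ^ d) * cont d hd (sumSet C D (G / L))) +
        ENNReal.ofReal (L ^ d) * cont d hd E := by
    refine (measure_mono hsub).trans ((measure_union_le _ _).trans ?_)
    refine add_le_add ?_ (cont_scale d hd L _ hL _)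
    refine (measure_biUnion_finset_le _ _).trans ?_
    refine (Finset.sum_le_sum fun p _ => cont_scale d hd L _ hL _).trans ?_
    rw [Finset.sum_const, nsmul_eq_mul]
  have hfin := cont_ne_top d hd _ hcomp
  have hfinE := cont_ne_top d hd _ hEc
  have h2 := ENNReal.toReal_mono (by finiteness) h
  rw [ENNReal.toReal_add (by finiteness) (by finiteness), ENNReal.toReal_mul, ENNReal.toReal_mul,
    ENNReal.toReal_mul, ENNReal.toReal_ofReal (by positivity), ENNReal.toReal_natCast] at h2
  have hcard' : (F.card : ℝ) = (Fintype.card ι : ℝ) * Fintype.card κ - 2 := by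
    have : (F.card : ℝ) + 2 = (Fintype.card ι : ℝ) * Fintype.card κ := by exact_mod_cast hcard
    linarith
  rw [hcard'] at h2
  exact h2

/-- upper semicontinuity at `1` -/
lemma cont_usc (d : ℝ) (hd : 0 < d) (C D : Set ℝ) (hCc : IsCompact C) (hDc : IsCompact D)
    (hD : D ⊆ Set.Icc 0 1) (c : ℝ) (hc : (cont d hd (sumSet C D 1)).toReal < c) :
    ∃ ε > 0, ∀ t : ℝ, |t - 1| < ε →
      (cont d hd (sumSet C D t ∪ (fun x => x + (t - 1)) '' sumSet C D t)).toReal ≤ c := by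
  have hcomp := sumSet_compact C D 1 hCc hDc
  have hfin := cont_ne_top d hd _ hcomp
  have hc0 : 0 ≤ c := ENNReal.toReal_nonneg.trans hc.le
  obtain ⟨U, hU, hsU, hUc⟩ := cont_open d hd (sumSet C D 1) (ENNReal.ofReal c)
    ((ENNReal.lt_ofReal_iff_toReal_lt hfin).2 hc)
  obtain ⟨δ, hδ, hδU⟩ := hcomp.exists_thickening_subset_open hU hsU
  refine ⟨δ / 2, by positivity, fun t ht => ?_⟩
  have hsub : sumSet C D t ∪ (fun x => x + (t - 1)) '' sumSet C D t ⊆ U := by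
    refine subset_trans ?_ hδU
    have key : ∀ y ∈ D, |(t - 1) * y| < δ / 2 := fun y hy => by
      rw [abs_mul, abs_of_nonneg (hD hy).1]
      have := mul_le_mul_of_nonneg_left (hD hy).2 (abs_nonneg (t - 1))
      linarith
    rintro z (⟨⟨x, y⟩, ⟨hx, hy⟩, rfl⟩ | ⟨_, ⟨⟨x, y⟩, ⟨hx, hy⟩, rfl⟩, rfl⟩)
    · refine Metric.mem_thickening_iff.2 ⟨x + 1 * y, ⟨(x, y), ⟨hx, hy⟩, rfl⟩, ?_⟩
      have := key y hy
      rw [Real.dist_eq, show x + t * y - (x + 1 * y) = (t - 1) * y by ring]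
      linarith
    · refine Metric.mem_thickening_iff.2 ⟨x + 1 * y, ⟨(x, y), ⟨hx, hy⟩, rfl⟩, ?_⟩
      have := key y hy
      rw [Real.dist_eq]
      simp only
      rw [show x + t * y + (t - 1) - (x + 1 * y) = (t - 1) * y + (t - 1) by ring]
      have := abs_add_le ((t - 1) * y) (t - 1)
      linarith
  exact ENNReal.toReal_le_of_le_ofReal hc0 ((measure_mono hsub).trans hUc.le)

lemma card_rpow (A : ℕ) (hA : 0 < A) (l : ℝ) (hl : l ∈ Set.Ioo (0:ℝ) 1) (dl : ℝ)
    (hdl : dl = Real.log A / Real.log (1/l)) (n : ℕ) : (A:ℝ) ^ n * (l ^ n) ^ dl = 1 := by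
  have hA' : (0:ℝ) < A := by exact_mod_cast hA
  have hlog := Real.log_neg hl.1 hl.2
  have h1 : (A:ℝ) * l ^ dl = 1 := by
    rw [Real.rpow_def_of_pos hl.1, ← Real.exp_log hA', ← Real.exp_add, Real.exp_eq_one_iff, hdl,
      one_div, Real.log_inv]
    have := hlog.ne
    field_simp
    ring
  rw [← Real.rpow_natCast l n, ← Real.rpow_mul hl.1.le, mul_comm (n:ℝ), Real.rpow_mul hl.1.le,
    Real.rpow_natCast, ← mul_pow, h1, one_pow]

theorem stmt4 (A B : ℕ) (l g : ℝ) (hl : l ∈ Set.Ioo (0:ℝ) 1) (hg : g ∈ Set.Ioo (0:ℝ) 1)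
    (b : Fin A → ℝ) (c : Fin B → ℝ) (Cl Cg : Set ℝ)
    (hClc : IsCompact Cl) (hCln : Cl.Nonempty)
    (hCgc : IsCompact Cg) (hCgn : Cg.Nonempty)
    (hClinv : Cl = ⋃ i : Fin A, (fun x => l * x + b i) '' Cl)
    (hCginv : Cg = ⋃ j : Fin B, (fun x => g * x + c j) '' Cg)
    (hClhull : convexHull ℝ Cl = Set.Icc (0:ℝ) 1)
    (hCghull : convexHull ℝ Cg = Set.Icc (0:ℝ) 1)
    (dl dg : ℝ) (hdl : dl = Real.log A / Real.log (1/l))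
    (hdg : dg = Real.log B / Real.log (1/g)) :
    μH[dl + dg] (Cl + Cg) = 0 := by
  obtain ⟨hl01, hl0, hl1⟩ := hull_facts Cl hClc hCln hClhull
  obtain ⟨hg01, hg0, hg1⟩ := hull_facts Cg hCgc hCgn hCghull
  have two : ∀ (N : ℕ) (r : ℝ) (a : Fin N → ℝ) (i j : Fin N), r < 1 → a i = 0 → a j = 1 - r →
      1 < N := by
    intro N r a i j hr hi hj
    have hij : i ≠ j := by
      rintro rfl
      linarith
    by_contra hcon
    apply hij
    ext
    omega
  have hA : 1 < A := by
    obtain ⟨i, j, hi, hj⟩ := ends _ Cl hl01 hl0 hl1 l hl.1 b hClinv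
    exact two A l b i j hl.2 hi hj
  have hB : 1 < B := by
    obtain ⟨i, j, hi, hj⟩ := ends _ Cg hg01 hg0 hg1 g hg.1 c hCginv
    exact two B g c i j hg.2 hi hj
  have dpos : ∀ (N : ℕ) (r : ℝ), 1 < N → r ∈ Set.Ioo (0:ℝ) 1 →
      0 < Real.log N / Real.log (1/r) := fun N r hN hr =>
    div_pos (Real.log_pos (by exact_mod_cast hN))
      (Real.log_pos (by rw [one_div]; exact (one_lt_inv₀ hr.1).2 hr.2))
  have hdlp : 0 < dl := hdl ▸ dpos A l hA hl
  have hdgp : 0 < dg := hdg ▸ dpos B g hB hg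
  have hd : 0 < dl + dg := add_pos hdlp hdgp
  set d := dl + dg with hddef
  have hSeq : Cl + Cg = sumSet Cl Cg 1 := by
    ext z
    simp only [sumSet, one_mul, Set.mem_add, Set.mem_image, Set.mem_prod, Prod.exists]
    constructor
    · rintro ⟨x, hx, y, hy, h⟩
      exact ⟨x, y, ⟨hx, hy⟩, h⟩
    · rintro ⟨x, y, ⟨hx, hy⟩, h⟩
      exact ⟨x, hx, y, hy, h⟩
  rw [hSeq]
  apply hausdorff_zero d hd
  have hfin := cont_ne_top d hd _ (sumSet_compact Cl Cg 1 hClc hCgc)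
  set φ : ℝ → ℝ := fun t => (cont d hd (sumSet Cl Cg t)).toReal with hφ
  set M := φ 1 with hM
  by_contra hne
  have hMpos : 0 < M := ENNReal.toReal_pos hne hfin
  -- normalization
  have hnorm : ∀ n m : ℕ, (A:ℝ) ^ n * (B:ℝ) ^ m * (l ^ n) ^ d * (g ^ m / l ^ n) ^ dg = 1 := by
    intro n m
    have h1 := card_rpow A (by omega) l hl dl hdl n
    have h2 := card_rpow B (by omega) g hg dg hdg m
    have hln : 0 < l ^ n := pow_pos hl.1 n
    have hgm : 0 < g ^ m := pow_pos hg.1 m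
    rw [Real.div_rpow hgm.le hln.le, hddef, Real.rpow_add hln]
    have := (Real.rpow_pos_of_pos hln dg).ne'
    field_simp
    linear_combination (B:ℝ) ^ m * (g ^ m) ^ dg * h1 + h2
  have hstep : ∀ (n m : ℕ) (t : ℝ), φ t ≤
      (A:ℝ) ^ n * (B:ℝ) ^ m * (l ^ n) ^ d * φ (t * g ^ m / l ^ n) := by
    intro n m t
    obtain ⟨β, hβ⟩ := iterate_ifs A Cl l b hClinv n
    obtain ⟨κ, hκ⟩ := iterate_ifs B Cg g c hCginv m
    have := cont_step _ _ d hd Cl Cg hClc hCgc (l ^ n) (g ^ m) (pow_pos hl.1 n) β κ hβ hκ t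
    simpa using this
  -- monotonicity and recurrence
  have hmax : ∀ n m : ℕ, φ (g ^ m / l ^ n) ≤ (g ^ m / l ^ n) ^ dg * M := by
    intro n0 m0
    have ht0 : 0 < g ^ m0 / l ^ n0 := div_pos (pow_pos hg.1 _) (pow_pos hl.1 _)
    set t0 := g ^ m0 / l ^ n0 with ht0def
    have hp : 0 < t0 ^ dg := Real.rpow_pos_of_pos ht0 _
    -- for every η in (0,1): (1-η) φ t0 ≤ t0^dg (M+η)
    have happrox : ∀ η : ℝ, 0 < η → η < 1 → (1 - η) * φ t0 ≤ t0 ^ dg * (M + η) := by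
      intro η hη hη1
      obtain ⟨ε, hε, husc⟩ := cont_usc d hd Cl Cg hClc hCgc hg01 (M + η)
        (by change M < M + η; linarith)
      have hcontp : Filter.Tendsto (fun x : ℝ => x ^ dg) (nhds 1) (nhds 1) := by
        simpa using (Real.continuousAt_rpow_const 1 dg (Or.inl one_ne_zero)).tendsto
      obtain ⟨ε', hε', hpow⟩ := Metric.tendsto_nhds_nhds.1 hcontp η hη
      obtain ⟨n, m, hn, hm, hnm⟩ := dirichlet l g hl hg (n0 + m0) (min ε ε') (lt_min hε hε')
      obtain ⟨n', rfl⟩ := Nat.exists_eq_add_of_le (show n0 ≤ n by omega)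
      obtain ⟨m', rfl⟩ := Nat.exists_eq_add_of_le (show m0 ≤ m by omega)
      have hs := hstep n' m' t0
      have hN := hnorm n' m'
      have hsp : 0 < g ^ m' / l ^ n' := div_pos (pow_pos hg.1 _) (pow_pos hl.1 _)
      have heq : t0 * g ^ m' / l ^ n' = g ^ (m0 + m') / l ^ (n0 + n') := by
        rw [ht0def, pow_add, pow_add]
        have := (pow_pos hl.1 n0).ne'
        have := (pow_pos hl.1 n').ne'
        field_simp
      have heq2 : t0 * (g ^ m' / l ^ n') = g ^ (m0 + m') / l ^ (n0 + n') := by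
        rw [← heq]; ring
      rw [heq] at hs
      set t := g ^ (m0 + m') / l ^ (n0 + n') with ht
      set W := (A:ℝ) ^ n' * (B:ℝ) ^ m' * (l ^ n') ^ d with hW
      have hφt : φ t ≤ M + η := by
        refine le_trans ?_ (husc t (hnm.trans_le (min_le_left _ _)))
        refine ENNReal.toReal_mono ?_ (measure_mono Set.subset_union_left)
        have hcomp := sumSet_compact Cl Cg t hClc hCgc
        exact cont_ne_top d hd _ (hcomp.union (hcomp.image (by fun_prop)))
      have htp : 1 - η < t ^ dg := by
        have := hpow (x := t) (by rw [Real.dist_eq]; exact hnm.trans_le (min_le_right _ _))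
        rw [Real.dist_eq] at this
        linarith [(abs_lt.1 this).1]
      rw [← heq2, Real.mul_rpow ht0.le hsp.le] at htp
      set σ := (g ^ m' / l ^ n') ^ dg with hσ
      have hσp : 0 < σ := Real.rpow_pos_of_pos hsp _
      have hφ0 : 0 ≤ φ t0 := ENNReal.toReal_nonneg
      calc (1 - η) * φ t0 ≤ t0 ^ dg * σ * φ t0 := mul_le_mul_of_nonneg_right htp.le hφ0
        _ ≤ t0 ^ dg * σ * (W * φ t) := mul_le_mul_of_nonneg_left hs (by positivity)
        _ = t0 ^ dg * φ t * (W * σ) := by ring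
        _ = t0 ^ dg * φ t := by rw [hN, mul_one]
        _ ≤ t0 ^ dg * (M + η) := mul_le_mul_of_nonneg_left hφt hp.le
    have hlim1 : Filter.Tendsto (fun η : ℝ => (1 - η) * φ t0) (nhdsWithin 0 (Set.Ioi 0))
        (nhds (φ t0)) := by
      have : Continuous (fun η : ℝ => (1 - η) * φ t0) := by fun_prop
      have h := this.tendsto 0
      simp only [sub_zero, one_mul] at h
      exact h.mono_left nhdsWithin_le_nhds
    have hlim2 : Filter.Tendsto (fun η : ℝ => t0 ^ dg * (M + η)) (nhdsWithin 0 (Set.Ioi 0))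
        (nhds (t0 ^ dg * M)) := by
      have : Continuous (fun η : ℝ => t0 ^ dg * (M + η)) := by fun_prop
      have h := this.tendsto 0
      simp only [add_zero] at h
      exact h.mono_left nhdsWithin_le_nhds
    refine le_of_tendsto_of_tendsto hlim1 hlim2 ?_
    filter_upwards [Ioo_mem_nhdsGT (show (0:ℝ) < 1 by norm_num)] with η hη
    exact happrox η hη.1 hη.2
  -- final contradiction
  obtain ⟨ε, hε, husc⟩ := cont_usc d hd Cl Cg hClc hCgc hg01 (3 / 2 * M)
    (by change M < 3 / 2 * M; linarith)
  have hcontp : Filter.Tendsto (fun x : ℝ => x ^ dg) (nhds 1) (nhds 1) := by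
    simpa using (Real.continuousAt_rpow_const 1 dg (Or.inl one_ne_zero)).tendsto
  obtain ⟨ε', hε', hpow⟩ := Metric.tendsto_nhds_nhds.1 hcontp (1/4) (by norm_num)
  obtain ⟨n, m, hn, hm, hnm⟩ := dirichlet l g hl hg 1 (min ε ε') (lt_min hε hε')
  obtain ⟨β, hβ⟩ := iterate_ifs A Cl l b hClinv n
  obtain ⟨κ, hκ⟩ := iterate_ifs B Cg g c hCginv m
  have hln : 0 < l ^ n := pow_pos hl.1 n
  have hgm : 0 < g ^ m := pow_pos hg.1 m
  obtain ⟨i0, i1, hi0, hi1⟩ := ends _ Cl hl01 hl0 hl1 (l ^ n) hln β hβ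
  obtain ⟨j0, j1, hj0, hj1⟩ := ends _ Cg hg01 hg0 hg1 (g ^ m) hgm κ hκ
  have hsave := cont_save _ _ d hd Cl Cg hClc hCgc (l ^ n) (g ^ m) hln
    (pow_lt_one₀ hl.1.le hl.2 (by omega)) β κ hβ hκ i0 i1 j0 j1 hi0 hi1 hj0 hj1
  have hE := husc (g ^ m / l ^ n) (hnm.trans_le (min_le_left _ _))
  have hT : 3 / 4 < (g ^ m / l ^ n) ^ dg := by
    have := hpow (x := g ^ m / l ^ n)
      (by rw [Real.dist_eq]; exact hnm.trans_le (min_le_right _ _))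
    rw [Real.dist_eq] at this
    linarith [(abs_lt.1 this).1]
  have hφT := hmax n m
  have hN := hnorm n m
  have hN4 : (2:ℝ) ≤ (A:ℝ) ^ n * (B:ℝ) ^ m := by
    have h1 : 1 ≤ A ^ n := Nat.one_le_pow _ _ (by omega)
    have h2 : 2 ≤ B ^ m := le_trans hB (Nat.le_self_pow (by omega) B)
    have h3 : 1 * 2 ≤ A ^ n * B ^ m := Nat.mul_le_mul h1 h2
    exact_mod_cast h3
  simp only [Fintype.card_pi, Fintype.card_fin, Finset.prod_const, Finset.card_univ,
    Nat.cast_pow] at hsave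
  change M ≤ ((A:ℝ) ^ n * (B:ℝ) ^ m - 2) * ((l ^ n) ^ d * φ (g ^ m / l ^ n)) + _ at hsave
  have hLd : 0 < (l ^ n) ^ d := Real.rpow_pos_of_pos hln _
  set Ld := (l ^ n) ^ d
  set τ := (g ^ m / l ^ n) ^ dg
  set NN := (A:ℝ) ^ n * (B:ℝ) ^ m
  have e1 : (NN - 2) * (Ld * φ (g ^ m / l ^ n)) ≤ (NN - 2) * (Ld * (τ * M)) :=
    mul_le_mul_of_nonneg_left (mul_le_mul_of_nonneg_left hφT hLd.le) (by linarith)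
  have e2 := mul_le_mul_of_nonneg_left hE hLd.le
  have e3 : (NN - 2) * (Ld * (τ * M)) = M - 2 * Ld * τ * M := by
    linear_combination M * hN
  have e4 : Ld * M * (3 / 4) < Ld * M * τ := mul_lt_mul_of_pos_left hT (by positivity)
  linarith
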